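/- Entry recovery via determinant expansion (key inequality in the proof of Lemma C.3): Let K ≥ 1 and τ > 0. There exists a constant C > 0, depending only on K and τ, such that for all matrices Λ1, Λ2, Λ̂1, Λ̂2 ∈ ℝ^{K×K} and all vectors λ, λ̂ ∈ ℝ^K with every entry of Λ1, Λ2, Λ̂1, Λ̂2, λ, λ̂ in [−τ, τ] and with Λ1Λ2ᵀ invertible, one has |‖λ‖² − ‖λ̂‖²| · |det(Λ1Λ2ᵀ)| ≤ C( ‖Λ1λ − Λ̂1λ̂‖ + ‖Λ2λ − Λ̂2λ̂‖ + ‖Λ1Λ2ᵀ − Λ̂1Λ̂2ᵀ‖_F ). -/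

import Mathlib

open Matrix

noncomputable section

/-- Euclidean norm of a real vector. -/
def eNorm {n : Type*} [Fintype n] (v : n → ℝ) : ℝ :=
  Real.sqrt (∑ i, (v i) ^ 2)

/-- Frobenius norm of a real matrix. -/
def frobNorm {m n : Type*} [Fintype m] [Fintype n] (A : Matrix m n ℝ) : ℝ :=
  Real.sqrt (∑ i, ∑ j, (A i j) ^ 2)

lemma abs_le_eNorm {n : Type*} [Fintype n] (v : n → ℝ) (i : n) : |v i| ≤ eNorm v :=
  Real.abs_le_sqrt (Finset.single_le_sum (f := fun i => v i ^ 2)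
    (fun _ _ => sq_nonneg _) (Finset.mem_univ i))

lemma abs_le_frobNorm {m n : Type*} [Fintype m] [Fintype n] (A : Matrix m n ℝ) (i : m) (j : n) :
    |A i j| ≤ frobNorm A := by
  refine Real.abs_le_sqrt ?_
  calc A i j ^ 2 ≤ ∑ j, A i j ^ 2 := Finset.single_le_sum (f := fun j => A i j ^ 2)
        (fun _ _ => sq_nonneg _) (Finset.mem_univ j)
    _ ≤ ∑ i, ∑ j, A i j ^ 2 := Finset.single_le_sum (f := fun i => ∑ j, A i j ^ 2)
        (fun _ _ => Finset.sum_nonneg fun _ _ => sq_nonneg _) (Finset.mem_univ i)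

lemma abs_prod_le_pow_card {ι : Type*} (s : Finset ι) {f : ι → ℝ} {R : ℝ}
    (hf : ∀ i, |f i| ≤ R) : |∏ i ∈ s, f i| ≤ R ^ s.card := by
  rw [Finset.abs_prod]
  simpa using Finset.prod_le_prod (s := s) (fun i _ => abs_nonneg (f i)) fun i _ => hf i

/-- Products of numbers bounded by `R ≥ 1` are Lipschitz in their factors. -/
lemma abs_prod_sub_prod_le {ι : Type*} (s : Finset ι) {f g : ι → ℝ} {R ε : ℝ} (hR : 1 ≤ R)
    (hf : ∀ i, |f i| ≤ R) (hg : ∀ i, |g i| ≤ R) (hfg : ∀ i, |f i - g i| ≤ ε) :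
    |∏ i ∈ s, f i - ∏ i ∈ s, g i| ≤ s.card * R ^ s.card * ε := by
  classical
  induction s using Finset.induction_on with
  | empty => simp
  | insert a s ha ih =>
    have hε : 0 ≤ ε := (abs_nonneg _).trans (hfg a)
    rw [Finset.prod_insert ha, Finset.prod_insert ha, Finset.card_insert_of_notMem ha]
    have hsplit : f a * ∏ i ∈ s, f i - g a * ∏ i ∈ s, g i =
        f a * (∏ i ∈ s, f i - ∏ i ∈ s, g i) + (f a - g a) * ∏ i ∈ s, g i := by ring
    have hpow : R ^ s.card ≤ R ^ (s.card + 1) := pow_le_pow_right₀ hR s.card.le_succ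
    rw [hsplit]
    calc _ ≤ |f a| * |∏ i ∈ s, f i - ∏ i ∈ s, g i| + |f a - g a| * |∏ i ∈ s, g i| := by
          rw [← abs_mul, ← abs_mul]
          exact abs_add_le _ _
      _ ≤ R * (s.card * R ^ s.card * ε) + ε * R ^ s.card := by
          gcongr
          · exact hf a
          · exact hfg a
          · exact abs_prod_le_pow_card s hg
      _ ≤ R * (s.card * R ^ s.card * ε) + ε * R ^ (s.card + 1) := by gcongr
      _ = _ := by push_cast; ring

/-- The determinant is Lipschitz on matrices with entries bounded by `R ≥ 1`. -/
lemma abs_det_sub_det_le {n : Type*} [Fintype n] [DecidableEq n] {A B : Matrix n n ℝ} {R ε : ℝ}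
    (hR : 1 ≤ R) (hA : ∀ i j, |A i j| ≤ R) (hB : ∀ i j, |B i j| ≤ R)
    (hAB : ∀ i j, |A i j - B i j| ≤ ε) :
    |A.det - B.det| ≤
      (Fintype.card n).factorial * (Fintype.card n * R ^ Fintype.card n) * ε := by
  rw [det_apply', det_apply', ← Finset.sum_sub_distrib]
  refine (Finset.abs_sum_le_sum_abs _ _).trans ?_
  calc _ ≤ ∑ _σ : Equiv.Perm n, Fintype.card n * R ^ Fintype.card n * ε := by
        refine Finset.sum_le_sum fun σ _ => ?_
        rw [← mul_sub, abs_mul]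
        have hsign : |((Equiv.Perm.sign σ : ℤ) : ℝ)| = 1 := by
          rcases Int.units_eq_one_or (Equiv.Perm.sign σ) with h | h <;> simp [h]
        rw [hsign, one_mul]
        exact abs_prod_sub_prod_le Finset.univ hR (fun i => hA (σ i) i) (fun i => hB (σ i) i)
          fun i => hAB (σ i) i
    _ = _ := by
        rw [Finset.sum_const, Finset.card_univ, Fintype.card_perm, nsmul_eq_mul, ← mul_assoc]

/-- The block matrix with corner `a`, first row `b`, first column `c` and remaining block `D`. -/
def bordered {n : Type*} (a : ℝ) (b c : n → ℝ) (D : Matrix n n ℝ) :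
    Matrix (Unit ⊕ n) (Unit ⊕ n) ℝ :=
  fromBlocks (of fun _ _ => a) (replicateRow Unit b) (replicateCol Unit c) D

lemma det_bordered_sub_det_bordered {n : Type*} [Fintype n] [DecidableEq n] (a a' : ℝ)
    (b c : n → ℝ) {D : Matrix n n ℝ} (hD : D.det ≠ 0) :
    (bordered a b c D).det - (bordered a' b c D).det = (a - a') * D.det := by
  let _ := D.invertibleOfIsUnitDet (isUnit_iff_ne_zero.mpr hD)
  rw [bordered, bordered, det_fromBlocks₂₂, det_fromBlocks₂₂, det_unique (n := Unit),
    det_unique (n := Unit)]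
  simp only [Matrix.sub_apply, of_apply]
  ring

/-- A Gram-type bordered matrix has rank at most `card n`, hence is singular. -/
lemma det_bordered_gram {n : Type*} [Fintype n] [DecidableEq n] (A B : Matrix n n ℝ)
    (v : n → ℝ) :
    (bordered (∑ i, v i ^ 2) (B.mulVec v) (A.mulVec v) (A * Bᵀ)).det = 0 := by
  have hfactor : bordered (∑ i, v i ^ 2) (B.mulVec v) (A.mulVec v) (A * Bᵀ) =
      fromBlocks (0 : Matrix Unit Unit ℝ) (replicateRow Unit v) 0 A *
        fromBlocks (0 : Matrix Unit Unit ℝ) 0 (replicateCol Unit v) Bᵀ := by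
    rw [fromBlocks_multiply, bordered]
    congr 1
    · ext; simp [Matrix.mul_apply, sq]
    · ext; simp [Matrix.mul_apply, mulVec, dotProduct, mul_comm]
    · ext; simp [Matrix.mul_apply, mulVec, dotProduct]
    · simp
  rw [hfactor, det_mul, det_fromBlocks_zero₂₁]
  simp

lemma abs_sum_mul_le {n : Type*} [Fintype n] {u v : n → ℝ} {τ : ℝ}
    (hu : ∀ i, |u i| ≤ τ) (hv : ∀ i, |v i| ≤ τ) :
    |∑ i, u i * v i| ≤ Fintype.card n * τ ^ 2 := by
  calc _ ≤ ∑ i, |u i * v i| := Finset.abs_sum_le_sum_abs _ _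
    _ ≤ ∑ _i : n, τ ^ 2 := by
        refine Finset.sum_le_sum fun i _ => ?_
        rw [abs_mul, sq]
        exact mul_le_mul (hu i) (hv i) (abs_nonneg _) ((abs_nonneg _).trans (hu i))
    _ = _ := by simp

lemma abs_bordered_le {n : Type*} {a R : ℝ} {b c : n → ℝ} {D : Matrix n n ℝ} (ha : |a| ≤ R)
    (hb : ∀ i, |b i| ≤ R) (hc : ∀ i, |c i| ≤ R) (hD : ∀ i j, |D i j| ≤ R) (i j : Unit ⊕ n) :
    |bordered a b c D i j| ≤ R := by
  rcases i with i | i <;> rcases j with j | j <;> simp [bordered, *]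

/-- **Entry recovery via determinant expansion** (key inequality in the proof of
Lemma C.3): there is a constant `C`, depending only on `K` and `τ`, bounding
`|‖λ‖² − ‖λ̂‖²|·|det(Λ1Λ2ᵀ)|` by the discrepancies of the products. -/
theorem entry_recovery_det_expansion (K : ℕ) (hK : 1 ≤ K) (τ : ℝ) (hτ : 0 < τ) :
    ∃ C : ℝ, 0 < C ∧
      ∀ (Λ1 Λ2 Λh1 Λh2 : Matrix (Fin K) (Fin K) ℝ) (lam lamh : Fin K → ℝ),
        (∀ i j, |Λ1 i j| ≤ τ) → (∀ i j, |Λ2 i j| ≤ τ) →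
        (∀ i j, |Λh1 i j| ≤ τ) → (∀ i j, |Λh2 i j| ≤ τ) →
        (∀ i, |lam i| ≤ τ) → (∀ i, |lamh i| ≤ τ) →
        (Λ1 * Λ2ᵀ).det ≠ 0 →
        |(∑ i, lam i ^ 2) - ∑ i, lamh i ^ 2| * |(Λ1 * Λ2ᵀ).det| ≤
          C * (eNorm (Λ1.mulVec lam - Λh1.mulVec lamh) +
               eNorm (Λ2.mulVec lam - Λh2.mulVec lamh) +
               frobNorm (Λ1 * Λ2ᵀ - Λh1 * Λh2ᵀ)) := by
  set R : ℝ := max 1 (K * τ ^ 2) with hRdef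
  have hR : 1 ≤ R := le_max_left _ _
  refine ⟨(K + 1).factorial * ((K + 1 : ℕ) * R ^ (K + 1)), by positivity, ?_⟩
  intro Λ1 Λ2 Λh1 Λh2 lam lamh h1 h2 hh1 hh2 hlam hlamh hdet
  have hdot {u v : Fin K → ℝ} (hu : ∀ i, |u i| ≤ τ) (hv : ∀ i, |v i| ≤ τ) :
      |∑ i, u i * v i| ≤ R := by
    simpa using (abs_sum_mul_le hu hv).trans (by simp [hRdef])
  have ha : |∑ i, lamh i ^ 2| ≤ R := by simpa only [sq] using hdot hlamh hlamh
  set x := eNorm (Λ1.mulVec lam - Λh1.mulVec lamh)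
  set y := eNorm (Λ2.mulVec lam - Λh2.mulVec lamh)
  set z := frobNorm (Λ1 * Λ2ᵀ - Λh1 * Λh2ᵀ)
  have hx0 : 0 ≤ x := Real.sqrt_nonneg _
  have hy0 : 0 ≤ y := Real.sqrt_nonneg _
  have hz0 : 0 ≤ z := Real.sqrt_nonneg _
  have hlip := abs_det_sub_det_le (ε := x + y + z) hR
    (abs_bordered_le ha (fun i => hdot (h2 i) hlam) (fun i => hdot (h1 i) hlam)
      (D := Λ1 * Λ2ᵀ) fun i j => hdot (h1 i) (h2 j))
    (abs_bordered_le ha (fun i => hdot (hh2 i) hlamh) (fun i => hdot (hh1 i) hlamh)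
      (D := Λh1 * Λh2ᵀ) fun i j => hdot (hh1 i) (hh2 j)) (by
      rintro (i | i) (j | j)
      · simpa [bordered] using by positivity
      · have := abs_le_eNorm (Λ2.mulVec lam - Λh2.mulVec lamh) j
        exact this.trans (by linarith)
      · have := abs_le_eNorm (Λ1.mulVec lam - Λh1.mulVec lamh) i
        exact this.trans (by linarith)
      · have := abs_le_frobNorm (Λ1 * Λ2ᵀ - Λh1 * Λh2ᵀ) i j
        exact this.trans (by linarith))
  have hcard : Fintype.card (Unit ⊕ Fin K) = K + 1 := by simp [add_comm]
  rw [hcard] at hlip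
  rw [← abs_mul, ← det_bordered_sub_det_bordered _ _ (Λ2.mulVec lam) (Λ1.mulVec lam) hdet,
    det_bordered_gram, ← det_bordered_gram Λh1 Λh2 lamh, abs_sub_comm]
  exact hlip
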